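/- Let A be a measurable 3-sum-free subset of [0,1]. Then μ(A) ≤ 28/57. -/

import Mathlib

open MeasureTheory Set

lemma vol_affine (c d : ℝ) (X : Set ℝ) :
    volume.real ((fun t => c * t + d) '' X) = |c| * volume.real X := by
  have h : (fun t => c * t + d) '' X = (fun t => t + d) '' ((fun t => c • t) '' X) := by
    rw [image_image]; rfl
  rw [h, Measure.real, Measure.real, image_add_right, measure_preimage_add_right, image_smul,
    Measure.addHaar_smul]
  simp

lemma vol_sub {X : Set ℝ} {p q : ℝ} (hpq : p ≤ q) (h : X ⊆ Icc p q) :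
    volume.real X ≤ q - p := by
  have := measureReal_mono (μ := volume) h (by simp)
  simpa [Real.volume_real_Icc_of_le hpq] using this

lemma pack {X Y : Set ℝ} {p q : ℝ} (hpq : p ≤ q) (hY : IsCompact Y)
    (hd : ∀ t, t ∈ X → t ∈ Y → False) (hXp : X ⊆ Icc p q) (hYp : Y ⊆ Icc p q) :
    volume.real X + volume.real Y ≤ q - p := by
  have hX' : volume X ≠ ⊤ := measure_ne_top_of_subset hXp (by simp)
  have hY' : volume Y ≠ ⊤ := measure_ne_top_of_subset hYp (by simp)
  rw [← measureReal_union (Set.disjoint_left.2 hd) hY.measurableSet hX' hY']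
  exact vol_sub hpq (union_subset hXp hYp)

open scoped Pointwise in
lemma discrete_freiman (p : ℕ) [Fact p.Prime] (B : Finset ℤ) (hB : B ⊆ Finset.Icc 0 (p : ℤ))
    (h0 : (0 : ℤ) ∈ B) (hp : (p : ℤ) ∈ B) :
    min (B.card + p) (3 * B.card - 3) ≤ (Finset.image₂ (· + ·) B B).card := by
  classical
  have hp0 : 0 < p := (Fact.out : p.Prime).pos
  set C := Finset.image₂ (· + ·) B B with hC
  let f : ℤ → ZMod p := fun i => (i : ZMod p)
  set B' := B.image f with hB'
  have hcard : B.card - 1 ≤ B'.card := by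
    rw [← Finset.card_erase_of_mem hp]
    refine Finset.card_le_card_of_injOn f ?_ ?_
    · intro i hi
      exact Finset.mem_coe.2 (Finset.mem_image_of_mem _ (Finset.mem_of_mem_erase hi))
    · intro i hi j hj hij
      have hi1 := Finset.mem_erase.1 (Finset.mem_coe.1 hi)
      have hj1 := Finset.mem_erase.1 (Finset.mem_coe.1 hj)
      have hi2 := Finset.mem_Icc.1 (hB hi1.2)
      have hj2 := Finset.mem_Icc.1 (hB hj1.2)
      have h3 := (ZMod.intCast_eq_intCast_iff i j p).1 hij
      have h4 : i % p = j % p := h3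
      rwa [Int.emod_eq_of_lt hi2.1 (lt_of_le_of_ne hi2.2 hi1.1),
        Int.emod_eq_of_lt hj2.1 (lt_of_le_of_ne hj2.2 hj1.1)] at h4
  have hne : B'.Nonempty := ⟨f 0, Finset.mem_image_of_mem _ h0⟩
  have cd := ZMod.cauchy_davenport (Fact.out : p.Prime) hne hne
  set E := B.image (fun b => b + (p : ℤ)) with hE
  have hEc : E.card = B.card := Finset.card_image_of_injective _ (add_left_injective _)
  have hEC : E ⊆ C := by
    intro e he
    obtain ⟨b, hb, rfl⟩ := Finset.mem_image.1 he
    exact Finset.mem_image₂_of_mem hb hp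
  have hBE : ∀ b ∈ B, b < p → b ∈ C \ E := by
    intro b hb hbp
    refine Finset.mem_sdiff.2 ⟨Finset.mem_image₂.2 ⟨b, hb, 0, h0, add_zero b⟩, fun he => ?_⟩
    obtain ⟨b', hb', h⟩ := Finset.mem_image.1 he
    have := Finset.mem_Icc.1 (hB hb')
    omega
  have hsub : B' + B' ⊆ (C \ E).image f := by
    intro u hu
    obtain ⟨v, hv, w, hw, rfl⟩ := Finset.mem_add.1 hu
    obtain ⟨i, hi, rfl⟩ := Finset.mem_image.1 hv
    obtain ⟨j, hj, rfl⟩ := Finset.mem_image.1 hw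
    by_cases hij : i + j ∈ E
    · obtain ⟨b, hb, h⟩ := Finset.mem_image.1 hij
      have hb2 := Finset.mem_Icc.1 (hB hb)
      have e1 : f i + f j = f b := by
        have : f i + f j = ((i + j : ℤ) : ZMod p) := by simp [f]
        rw [this, ← h]; simp [f]
      rcases lt_or_eq_of_le hb2.2 with hlt | heq
      · exact Finset.mem_image.2 ⟨b, hBE b hb hlt, e1.symm⟩
      · refine Finset.mem_image.2 ⟨0, hBE 0 h0 (by omega), ?_⟩
        rw [e1, heq]; simp [f]
    · refine Finset.mem_image.2 ⟨i + j, Finset.mem_sdiff.2 ⟨Finset.mem_image₂_of_mem hi hj, hij⟩, ?_⟩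
      simp [f]
  have h5 := (Finset.card_le_card hsub).trans Finset.card_image_le
  have h6 := Finset.card_sdiff_add_card_eq_card hEC
  omega

lemma freiman {A : Set ℝ} (hA : IsCompact A) {a s : ℝ} (ha : a ∈ A) (hs : s ∈ A)
    (hAs : A ⊆ Icc a s) :
    min (3 * volume.real A) (volume.real A + (s - a)) ≤
      volume.real (image2 (· + ·) A A) := by
  classical
  have has : a ≤ s := (hAs ha).2
  rcases has.eq_or_lt with heq | hlt
  · have := vol_sub has hAs
    refine (min_le_left _ _).trans ?_
    have h2 : 0 ≤ volume.real (image2 (· + ·) A A) := measureReal_nonneg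
    linarith
  set S := image2 (· + ·) A A with hS
  have hSc : IsCompact S := by
    rw [hS, ← image_prod]
    exact (hA.prod hA).image (by fun_prop)
  refine le_of_forall_pos_le_add fun η hη => ?_
  have ht := tendsto_measure_cthickening_of_isCompact (μ := (volume : Measure ℝ)) hSc
  have hfin : volume S ≠ ⊤ := hSc.measure_lt_top.ne
  have hev := ht.eventually_lt_const
    (show volume S < volume S + ENNReal.ofReal (η / 2) from
      ENNReal.lt_add_right hfin (by simpa using hη))
  obtain ⟨r, hr, hball⟩ := Metric.eventually_nhds_iff.1 hev
  have hD : 0 < s - a := by linarith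
  obtain ⟨N, hN⟩ := exists_nat_gt (max (2 * (s - a) / r) (6 * (s - a) / η))
  obtain ⟨p, hNp, hpp⟩ := Nat.exists_infinite_primes (N + 1)
  have : Fact p.Prime := ⟨hpp⟩
  have hpN : (N : ℝ) < p := by exact_mod_cast hNp
  have hp0 : (0 : ℝ) < p := by exact_mod_cast hpp.pos
  set h := (s - a) / p with hh
  have hhp : h * p = s - a := by rw [hh]; field_simp
  have hh0 : 0 < h := by positivity
  have h2r : 2 * h < r := by
    have : 2 * (s - a) / r < p := lt_of_le_of_lt (le_max_left _ _) (hN.trans hpN)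
    rw [div_lt_iff₀ hr] at this
    rw [← hhp] at this
    nlinarith
  have h6 : 3 * h < η / 2 := by
    have : 6 * (s - a) / η < p := lt_of_le_of_lt (le_max_right _ _) (hN.trans hpN)
    rw [div_lt_iff₀ hη] at this
    rw [← hhp] at this
    nlinarith
  have hcth := hball (y := 2 * h) (by rw [Real.dist_eq, sub_zero, abs_of_pos] <;> linarith)
  -- index set
  set B : Finset ℤ := (Finset.Icc 0 (p : ℤ)).filter (fun i => ∃ t ∈ A, ⌊(t - a) / h⌋ = i) with hB
  have hidx : ∀ t ∈ A, ⌊(t - a) / h⌋ ∈ B := by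
    intro t htA
    have h1 := hAs htA
    refine Finset.mem_filter.2 ⟨Finset.mem_Icc.2 ⟨?_, ?_⟩, t, htA, rfl⟩
    · exact Int.floor_nonneg.2 (div_nonneg (by linarith [h1.1]) hh0.le)
    · have : (t - a) / h ≤ p := by
        rw [div_le_iff₀ hh0]; linarith [h1.2]
      have h3 : ((⌊(t - a) / h⌋ : ℤ) : ℝ) ≤ ((p : ℤ) : ℝ) := (Int.floor_le _).trans (by simpa using this)
      exact_mod_cast h3
  have hB0 : (0 : ℤ) ∈ B := by simpa using hidx a ha
  have hBp : (p : ℤ) ∈ B := by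
    have e : (s - a) / h = (p : ℝ) := by rw [div_eq_iff hh0.ne']; linarith
    have := hidx s hs
    rwa [e, Int.floor_natCast] at this
  have hfr := discrete_freiman p B (Finset.filter_subset _ _) hB0 hBp
  set C := Finset.image₂ (· + ·) B B with hC
  have hfl : ∀ t : ℝ, (⌊(t - a) / h⌋ : ℝ) * h ≤ t - a ∧ t - a < (⌊(t - a) / h⌋ + 1 : ℝ) * h := by
    intro t
    constructor
    · rw [← le_div_iff₀ hh0]; exact Int.floor_le _
    · rw [← div_lt_iff₀ hh0]; exact Int.lt_floor_add_one _
  have hm : volume.real A ≤ B.card * h := by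
    have hsub : A ⊆ ⋃ i ∈ B, Ico (a + i * h) (a + (i + 1) * h) := by
      intro t htA
      simp only [mem_iUnion]
      exact ⟨_, hidx t htA, by linarith [(hfl t).1], by linarith [(hfl t).2]⟩
    have hf : volume (⋃ i ∈ B, Ico (a + i * h) (a + (i + 1) * h)) ≠ ⊤ :=
      (measure_biUnion_lt_top B.finite_toSet (by simp)).ne
    refine (measureReal_mono hsub hf).trans ((measureReal_biUnion_finset_le _ _).trans ?_)
    have : ∀ i ∈ B, volume.real (Ico (a + i * h) (a + (i + 1) * h)) = h := by
      intro i _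
      rw [Real.volume_real_Ico_of_le (by linarith)]; ring
    rw [Finset.sum_congr rfl this]; simp
  have hcl : (C.card : ℝ) * h ≤ volume.real (Metric.cthickening (2 * h) S) := by
    have hsub : (⋃ k ∈ C, Ico (2 * a + k * h) (2 * a + (k + 1) * h)) ⊆
        Metric.cthickening (2 * h) S := by
      intro u hu
      simp only [mem_iUnion] at hu
      obtain ⟨k, hk, hu⟩ := hu
      obtain ⟨i, hi, j, hj, rfl⟩ := Finset.mem_image₂.1 hk
      obtain ⟨t, htA, rfl⟩ := (Finset.mem_filter.1 hi).2
      obtain ⟨t', htA', rfl⟩ := (Finset.mem_filter.1 hj).2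
      have h1 := hfl t
      have h2 := hfl t'
      refine Metric.mem_cthickening_of_dist_le u (t + t') _ _ ⟨t, htA, t', htA', rfl⟩ ?_
      have h3 := hu.1
      have h4 := hu.2
      push_cast at h3 h4
      rw [Real.dist_eq, abs_le]
      constructor <;> linarith
    have hmeq : volume.real (⋃ k ∈ C, Ico (2 * a + k * h) (2 * a + (k + 1) * h)) = C.card * h := by
      rw [measureReal_biUnion_finset (h := fun i _ => by
        rw [Real.volume_Ico]; exact ENNReal.ofReal_ne_top)]
      · have : ∀ k ∈ C, volume.real (Ico (2 * a + k * h) (2 * a + (k + 1) * h)) = h := by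
          intro i _
          rw [Real.volume_real_Ico_of_le (by linarith)]; ring
        rw [Finset.sum_congr rfl this]; simp
      · intro i _ j _ hij
        refine Set.disjoint_left.2 fun u hu hv => hij ?_
        have e1 : (i : ℝ) * h < (j + 1) * h := by linarith [hu.1, hv.2]
        have e2 : (j : ℝ) * h < (i + 1) * h := by linarith [hv.1, hu.2]
        have e1' := lt_of_mul_lt_mul_right e1 hh0.le
        have e2' := lt_of_mul_lt_mul_right e2 hh0.le
        norm_cast at e1' e2'
        omega
      · intro i _
        exact measurableSet_Ico
    rw [← hmeq]
    exact measureReal_mono hsub (hcth.trans_le le_top).ne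
  have hcr : volume.real (Metric.cthickening (2 * h) S) ≤ volume.real S + η / 2 := by
    have := ENNReal.toReal_mono (by simp [hfin]) hcth.le
    rwa [ENNReal.toReal_add hfin (by simp), ENNReal.toReal_ofReal (by linarith)] at this
  rcases min_le_iff.1 hfr with h1 | h1
  · refine (min_le_right _ _).trans ?_
    have h2 : ((B.card : ℝ) + p) ≤ C.card := by exact_mod_cast h1
    have := mul_le_mul_of_nonneg_right h2 hh0.le
    linarith
  · refine (min_le_left _ _).trans ?_
    have h2 : (3 * (B.card : ℝ)) ≤ C.card + 3 := by
      have : 3 * B.card ≤ C.card + 3 := by omega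
      exact_mod_cast this
    have := mul_le_mul_of_nonneg_right h2 hh0.le
    linarith

def SF (A : Set ℝ) : Prop := ∀ x ∈ A, ∀ y ∈ A, ∀ z ∈ A, x + y ≠ 3 * z

lemma SF.mono {A B : Set ℝ} (h : SF A) (hBA : B ⊆ A) : SF B :=
  fun x hx y hy z hz => h x (hBA hx) y (hBA hy) z (hBA hz)

lemma vol_cover {A X Y : Set ℝ} (hX : IsCompact X) (hY : IsCompact Y) (h : A ⊆ X ∪ Y) :
    volume.real A ≤ volume.real X + volume.real Y :=
  (measureReal_mono h (hX.union hY).measure_lt_top.ne).trans (measureReal_union_le _ _)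

/-- key inequality -/
lemma key {A : Set ℝ} (hA : IsCompact A) (hsf : SF A) {a s : ℝ} (ha : a ∈ A) (hs : s ∈ A)
    (hAs : A ⊆ Icc a s) (ha0 : 0 ≤ a) :
    3 * volume.real (A ∩ Icc 0 (2 * s / 3)) ≤ 2 * s - 3 * volume.real A ∨
    3 * volume.real (A ∩ Icc 0 (2 * s / 3)) ≤ s - volume.real A := by
  have has : a ≤ s := (hAs ha).2
  have hf := freiman hA ha hs hAs
  have hXc : IsCompact (A ∩ Icc 0 (2 * s / 3)) := hA.inter_right isClosed_Icc
  have hp := pack (X := image2 (· + ·) A A)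
    (Y := (fun t => 3 * t + 0) '' (A ∩ Icc 0 (2 * s / 3))) (p := 2 * a) (q := 2 * s)
    (by linarith) (hXc.image (by fun_prop))
    (by
      rintro t ⟨x, hx, y, hy, rfl⟩ ⟨z, hz, h⟩
      simp only at h
      exact hsf x hx y hy z hz.1 (by linarith))
    (by
      rintro t ⟨x, hx, y, hy, rfl⟩
      have h1 := hAs hx
      have h2 := hAs hy
      exact ⟨by simp only; linarith [h1.1, h2.1], by simp only; linarith [h1.2, h2.2]⟩)
    (by
      rintro t ⟨z, hz, rfl⟩
      have h1 := hAs hz.1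
      exact ⟨by simp only; linarith [h1.1], by simp only; linarith [hz.2.2]⟩)
  rw [vol_affine, abs_of_pos (by norm_num : (0 : ℝ) < 3)] at hp
  rcases min_le_iff.1 hf with h | h
  · left; linarith
  · right; linarith

lemma half {A : Set ℝ} (hA : IsCompact A) (hsf : SF A) {s : ℝ} (hs0 : 0 ≤ s)
    (hAs : A ⊆ Icc 0 s) : volume.real A ≤ s / 2 := by
  rcases A.eq_empty_or_nonempty with rfl | hne
  · simp; linarith
  obtain ⟨a, ha, ha'⟩ := hA.exists_isLeast hne
  obtain ⟨b, hb, hb'⟩ := hA.exists_isGreatest hne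
  have h0a := (hAs ha).1
  have hbs := (hAs hb).2
  have hab : a ≤ b := ha' hb
  have hy := vol_sub (X := A ∩ Icc (2 * b / 3) b) (by linarith) inter_subset_right
  have hc := vol_cover (A := A) (X := A ∩ Icc 0 (2 * b / 3)) (Y := A ∩ Icc (2 * b / 3) b)
    (hA.inter_right isClosed_Icc) (hA.inter_right isClosed_Icc)
    (fun t ht => by
      rcases le_total t (2 * b / 3) with h | h
      · exact Or.inl ⟨ht, (hAs ht).1, h⟩
      · exact Or.inr ⟨ht, h, hb' ht⟩)
  rcases key hA hsf ha hb (fun t ht => ⟨ha' ht, hb' ht⟩) h0a with h | h <;> linarith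

lemma refl_bound {A : Set ℝ} (hA : IsCompact A) (hsf : SF A) {z p q : ℝ} (hz : z ∈ A)
    (hpq : p ≤ q) (h : p + q = 3 * z) : volume.real (A ∩ Icc p q) ≤ (q - p) / 2 := by
  have hXc : IsCompact (A ∩ Icc p q) := hA.inter_right isClosed_Icc
  have hp := pack (X := A ∩ Icc p q) (Y := (fun t => (-1) * t + 3 * z) '' (A ∩ Icc p q)) hpq
    (hXc.image (by fun_prop))
    (by
      rintro t ht ⟨x, hx, e⟩
      simp only at e
      exact hsf t ht.1 x hx.1 z hz (by linarith))
    inter_subset_right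
    (by
      rintro t ⟨x, hx, rfl⟩
      exact ⟨by simp only; linarith [hx.2.2], by simp only; linarith [hx.2.1]⟩)
  rw [vol_affine] at hp
  norm_num at hp
  linarith

lemma shift_bound {A : Set ℝ} (hA : IsCompact A) (hsf : SF A) {z p q : ℝ} (hz : z ∈ A)
    (hpq : p ≤ q) : volume.real (A ∩ Icc p q) +
      3 * volume.real (A ∩ Icc ((p + z) / 3) ((q + z) / 3)) ≤ q - p := by
  have hp := pack (X := (fun t => 1 * t + z) '' (A ∩ Icc p q))
    (Y := (fun t => 3 * t + 0) '' (A ∩ Icc ((p + z) / 3) ((q + z) / 3)))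
    (p := p + z) (q := q + z) (by linarith)
    ((hA.inter_right isClosed_Icc).image (by fun_prop))
    (by
      rintro t ⟨x, hx, rfl⟩ ⟨y, hy, e⟩
      simp only at e
      exact hsf x hx.1 z hz y hy.1 (by linarith))
    (by
      rintro t ⟨x, hx, rfl⟩
      exact ⟨by simp only; linarith [hx.2.1], by simp only; linarith [hx.2.2]⟩)
    (by
      rintro t ⟨x, hx, rfl⟩
      exact ⟨by simp only; linarith [hx.2.1], by simp only; linarith [hx.2.2]⟩)
  rw [vol_affine, vol_affine] at hp
  norm_num at hp
  linarith

lemma main_compact {A : Set ℝ} (hA : IsCompact A) (hsf : SF A) (h01 : A ⊆ Icc 0 1)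
    (hm : 28 / 57 < volume.real A) : False := by
  have hne : A.Nonempty := by
    rcases A.eq_empty_or_nonempty with rfl | hne
    · simp at hm; linarith
    · exact hne
  have hI : ∀ p q : ℝ, IsCompact (A ∩ Icc p q) := fun p q => hA.inter_right isClosed_Icc
  obtain ⟨a, ha, ha'⟩ := hA.exists_isLeast hne
  obtain ⟨s, hs, hs'⟩ := hA.exists_isGreatest hne
  have h0a := (h01 ha).1
  have hs1 := (h01 hs).2
  have has : a ≤ s := ha' hs
  have hA0s : A ⊆ Icc 0 s := fun t ht => ⟨(h01 ht).1, hs' ht⟩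
  have hs0 : 0 ≤ s := by linarith
  have hcov : ∀ p q r : ℝ, volume.real (A ∩ Icc p r) ≤
      volume.real (A ∩ Icc p q) + volume.real (A ∩ Icc q r) := fun p q r =>
    vol_cover (hI _ _) (hI _ _) (fun t ht => by
      rcases le_total t q with h | h
      · exact Or.inl ⟨ht.1, ht.2.1, h⟩
      · exact Or.inr ⟨ht.1, h, ht.2.2⟩)
  have hlen : ∀ p q : ℝ, p ≤ q → volume.real (A ∩ Icc p q) ≤ q - p := fun p q h =>
    vol_sub h inter_subset_right
  have hAA : A ∩ Icc 0 s = A := inter_eq_left.2 hA0s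
  have hc := hcov 0 (2 * s / 3) s
  rw [hAA] at hc
  have hy := hlen (2 * s / 3) s (by linarith)
  set y := volume.real (A ∩ Icc (2 * s / 3) s) with hyd
  set x := volume.real (A ∩ Icc 0 (2 * s / 3)) with hxd
  set m := volume.real A with hmd
  obtain ⟨ε, hε⟩ : ∃ ε, ε = s / 3 - y := ⟨_, rfl⟩
  have hms : 28 / 57 * s < m := by linarith
  have hε1 : ε < s / 57 := by
    rcases key hA hsf ha hs (fun t ht => ⟨ha' ht, hs' ht⟩) h0a with h | h <;> linarith
  have hε0 : 0 ≤ ε := by linarith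
  have hsp : 0 < s := by linarith
  -- gap
  have hgap : ∀ z ∈ A, z ≤ 4 * s / 9 + 2 * ε / 3 ∨ 2 * s / 3 - 2 * ε / 3 ≤ z := by
    intro z hz
    by_contra! hcon
    obtain ⟨h1, h2⟩ := hcon
    rcases le_total z (5 * s / 9) with h | h
    · have e1 := refl_bound hA hsf hz (p := 2 * s / 3) (q := 3 * z - 2 * s / 3)
        (by linarith) (by ring)
      have e2 := hcov (2 * s / 3) (3 * z - 2 * s / 3) s
      have e3 := hlen (3 * z - 2 * s / 3) s (by linarith)
      linarith
    · have e1 := refl_bound hA hsf hz (p := 3 * z - s) (q := s)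
        (by linarith) (by ring)
      have e2 := hcov (2 * s / 3) (3 * z - s) s
      have e3 := hlen (2 * s / 3) (3 * z - s) (by linarith)
      linarith
  -- lower part
  have hA1 : x ≤ volume.real (A ∩ Icc 0 (4 * s / 9 + 2 * ε / 3)) + 2 * ε / 3 := by
    have e := vol_cover (A := A ∩ Icc 0 (2 * s / 3)) (hI 0 (4 * s / 9 + 2 * ε / 3))
      (hI (2 * s / 3 - 2 * ε / 3) (2 * s / 3)) (fun t ht => by
        rcases hgap t ht.1 with h | h
        · exact Or.inl ⟨ht.1, ht.2.1, h⟩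
        · exact Or.inr ⟨ht.1, h, ht.2.2⟩)
    have e3 := hlen (2 * s / 3 - 2 * ε / 3) (2 * s / 3) (by linarith)
    linarith
  have hne1 : (A ∩ Icc 0 (4 * s / 9 + 2 * ε / 3)).Nonempty := by
    by_contra hcon
    rw [not_nonempty_iff_eq_empty] at hcon
    rw [hcon] at hA1
    simp at hA1
    linarith
  obtain ⟨b, hb, hb'⟩ := (hI 0 (4 * s / 9 + 2 * ε / 3)).exists_isGreatest hne1
  have hb0 := hb.2.1
  have hb1 := hb.2.2
  have hA2 : volume.real (A ∩ Icc 0 (4 * s / 9 + 2 * ε / 3)) ≤ volume.real (A ∩ Icc 0 b) :=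
    measureReal_mono (fun t ht => ⟨ht.1, ht.2.1, hb' ht⟩) (hI _ _).measure_lt_top.ne
  obtain ⟨c, hcd⟩ : ∃ c, c = max 0 (b - s / 3) := ⟨_, rfl⟩
  have hc0 : 0 ≤ c := hcd ▸ le_max_left _ _
  have hc1 : b - s / 3 ≤ c := hcd ▸ le_max_right _ _
  have hcb : c ≤ b := by rw [hcd]; exact max_le hb0 (by linarith)
  have hc2 : c ≤ s / 9 + 2 * ε / 3 := by rw [hcd]; exact max_le (by linarith) (by linarith)
  obtain ⟨z, hz, hz'⟩ := (hI c b).exists_isLeast ⟨b, hb.1, hcb, le_rfl⟩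
  have hzc := hz.2.1
  have hzb := hz.2.2
  have hsz := shift_bound hA hsf hz.1 (p := 2 * s / 3) (q := s) (by linarith)
  have hsb := shift_bound hA hsf hb.1 (p := 2 * s / 3) (q := s) (by linarith)
  obtain ⟨t, htd⟩ : ∃ t, t = (2 * s / 3 + z) / 3 := ⟨_, rfl⟩
  rw [← htd] at hsz
  have ht0 : 0 ≤ t := by rw [htd]; linarith
  have hA3 : volume.real (A ∩ Icc t b) ≤ 2 * ε / 3 := by
    have e := vol_cover (A := A ∩ Icc t b) (hI t ((s + z) / 3))
      (hI ((2 * s / 3 + b) / 3) ((s + b) / 3)) (fun u hu => by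
        rcases le_total u ((s + z) / 3) with h | h
        · exact Or.inl ⟨hu.1, hu.2.1, h⟩
        · exact Or.inr ⟨hu.1, by linarith, by linarith [hu.2.2]⟩)
    linarith
  have hA4 := hcov 0 t b
  have hA5 := half (hI 0 t) (hsf.mono inter_subset_left) ht0 inter_subset_right
  have hA6 := half (hI 0 c) (hsf.mono inter_subset_left) hc0 inter_subset_right
  -- A ∩ [0,b] = A ∩ [0,c] ∪ A ∩ [z,b]
  have hA7 : volume.real (A ∩ Icc 0 b) ≤
      volume.real (A ∩ Icc 0 c) + volume.real (A ∩ Icc z b) :=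
    vol_cover (hI _ _) (hI _ _) (fun u hu => by
      rcases le_total u c with h | h
      · exact Or.inl ⟨hu.1, hu.2.1, h⟩
      · exact Or.inr ⟨hu.1, hz' ⟨hu.1, h, hu.2.2⟩, hu.2.2⟩)
  have hA8 := hcov z t b
  rcases le_total z t with hzt | hzt
  · have hA9 := hlen z t hzt
    linarith
  · have hA9 : volume.real (A ∩ Icc z b) ≤ volume.real (A ∩ Icc t b) :=
      measureReal_mono (fun u hu => ⟨hu.1, hzt.trans hu.2.1, hu.2.2⟩) (hI _ _).measure_lt_top.ne
    linarith

/-- **Matolcsi–Ruzsa theorem.** If `A` is a measurable 3-sum-free subset of `[0,1]`,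
then its Lebesgue measure is at most `28/57`. -/
theorem measure_le_28_57_of_three_sum_free (A : Set ℝ)
    (hA : A ⊆ Icc (0 : ℝ) 1) (hmeas : MeasurableSet A)
    (hsf : ∀ x ∈ A, ∀ y ∈ A, ∀ z ∈ A, x + y ≠ 3 * z) :
    volume A ≤ 28 / 57 := by
  by_contra! hcon
  obtain ⟨K, hKA, hK, hlt⟩ := hmeas.exists_lt_isCompact hcon
  refine main_compact hK (SF.mono hsf hKA) (hKA.trans hA) ?_
  have := (ENNReal.toReal_lt_toReal (hlt.trans_le le_top).ne hK.measure_lt_top.ne).2 hlt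
  simpa [Measure.real] using this
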